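/- arXiv:1011.4647 — 2 statements merged into one kernel-verified Lean document; each statement's English description precedes it below -/
import Mathlib

section
/- Let (V, φ, ξ) be an almost contact metric vector space, let e₁, e₂ ∈ V be orthonormal with η(e₁) = 0, and let H ∈ V satisfy ⟪H, e₂⟫ = 0 and ⟪φ(H), e₂⟫ = 0. Set a = ⟪φ(e₂), e₁⟫ and b = ⟪φ(H), e₁⟫, and assume a ≠ 0, b ≠ 0 and the vector identity 2a·φ(H) + b·φ(e₂) - η(e₂)η(H)·e₁ = 0 holds. Then ‖H‖² - η(H)² = 3b² and 1 - η(e₂)² = 9a², and moreover 3ab = η(e₂)η(H). (These are equations (5.5)–(5.8) of the paper, obtained by pairing the vector identity with φ(H), e₁ and φ(e₂).) -/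
open RealInnerProductSpace

/-- Pairing the vector identity (5.4) with `φH`, `e₁` and `φe₂` yields equations
(5.5)–(5.8): `‖H‖² - η(H)² = 3b²`, `1 - η(e₂)² = 9a²` and `3ab = η(e₂)η(H)`, where
`a = ⟪φ e₂, e₁⟫` and `b = ⟪φ H, e₁⟫`. -/
theorem stmt_7 {V : Type*} [NormedAddCommGroup V] [InnerProductSpace ℝ V]
    (φ : V →ₗ[ℝ] V) (ξ : V) (hξ : ‖ξ‖ = 1)
    (hφ2 : ∀ U : V, φ (φ U) = -U + ⟪U, ξ⟫ • ξ)
    (hφinner : ∀ U W : V, ⟪φ U, φ W⟫ = ⟪U, W⟫ - ⟪U, ξ⟫ * ⟪W, ξ⟫)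
    (e₁ e₂ H : V)
    (he₁ : ‖e₁‖ = 1) (he₂ : ‖e₂‖ = 1) (he₁e₂ : ⟪e₁, e₂⟫ = 0)
    (hηe₁ : ⟪e₁, ξ⟫ = 0)
    (hHe₂ : ⟪H, e₂⟫ = 0) (hφHe₂ : ⟪φ H, e₂⟫ = 0)
    (a b : ℝ) (ha : a = ⟪φ e₂, e₁⟫) (hb : b = ⟪φ H, e₁⟫)
    (ha0 : a ≠ 0) (hb0 : b ≠ 0)
    (hid : (2 * a) • φ H + b • φ e₂ - (⟪e₂, ξ⟫ * ⟪H, ξ⟫) • e₁ = 0) :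
    ‖H‖ ^ 2 - ⟪H, ξ⟫ ^ 2 = 3 * b ^ 2 ∧
    1 - ⟪e₂, ξ⟫ ^ 2 = 9 * a ^ 2 ∧
    3 * a * b = ⟪e₂, ξ⟫ * ⟪H, ξ⟫ := by
  have pair : ∀ W : V, 2 * a * ⟪φ H, W⟫ + b * ⟪φ e₂, W⟫ - ⟪e₂, ξ⟫ * ⟪H, ξ⟫ * ⟪e₁, W⟫ = 0 := by
    intro W
    have h := congrArg (fun X : V => ⟪X, W⟫) hid
    simpa only [inner_sub_left, inner_add_left, real_inner_smul_left, inner_zero_left] using h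
  have h₁ := pair e₁
  have hH := pair (φ H)
  have h₂ := pair (φ e₂)
  rw [← ha, ← hb, real_inner_self_eq_norm_sq, he₁] at h₁
  rw [hφinner, hφinner, real_inner_self_eq_norm_sq, real_inner_comm H e₂, hHe₂,
    real_inner_comm (φ H) e₁, ← hb] at hH
  rw [hφinner, hφinner, real_inner_self_eq_norm_sq, he₂, hHe₂,
    real_inner_comm (φ e₂) e₁, ← ha] at h₂
  have hab : ⟪e₂, ξ⟫ * ⟪H, ξ⟫ = 3 * a * b := by linarith
  refine ⟨mul_left_cancel₀ ha0 ?_, mul_left_cancel₀ hb0 ?_, hab.symm⟩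
  · linear_combination hH / 2 + b * hab
  · linear_combination h₂ + 3 * a * hab
end

section
/- Let (V, φ, ξ) be an almost contact metric vector space, ρ ∈ ℝ with ρ ≠ 0, and let R be the cosymplectic space-form curvature operator with parameter ρ. Let e₁, e₂ ∈ V be orthonormal with η(e₁) = η(e₂) = 0, and let H ∈ V satisfy ⟪H, e₁⟫ = ⟪H, e₂⟫ = 0, η(H) = 0 and ⟪e₁, φ(e₂)⟫ = 0. If R(e₁, e₂)H = 0, then ⟪φ(H), e₁⟫ = 0 and ⟪φ(H), e₂⟫ = 0, i.e. φ(H) is orthogonal to the plane spanned by e₁ and e₂. (This is the linear-algebra content of the implication (iii) ⟹ (iv) in Lemma 5.4: for a pseudo-umbilical pmc surface with R^N(X,Y)H = 0, anti-invariance of the tangent plane forces φH to be normal.) -/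
open RealInnerProductSpace

/-- The curvature operator of a cosymplectic space form of constant φ-sectional curvature ρ. -/
noncomputable def cosR {V : Type*} [NormedAddCommGroup V] [InnerProductSpace ℝ V]
    (φ : V →ₗ[ℝ] V) (ξ : V) (ρ : ℝ) (X Y Z : V) : V :=
  (ρ / 4) • (⟪Y, Z⟫ • X - ⟪X, Z⟫ • Y + ⟪X, φ Z⟫ • φ Y - ⟪Y, φ Z⟫ • φ X
    + (2 * ⟪X, φ Y⟫) • φ Z + (⟪X, ξ⟫ * ⟪Z, ξ⟫) • Y - (⟪Y, ξ⟫ * ⟪Z, ξ⟫) • X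
    + (⟪X, Z⟫ * ⟪Y, ξ⟫) • ξ - (⟪Y, Z⟫ * ⟪X, ξ⟫) • ξ)

/-- (iii) ⟹ (iv) in Lemma 5.4. For an anti-invariant tangent plane
(`⟪e₁, φ e₂⟫ = 0`), with `e₁, e₂, H, ξ`-orthogonalities as stated and `R(e₁,e₂)H = 0`,
`φ H` is orthogonal to the plane spanned by `e₁` and `e₂`. -/
theorem stmt_12 {V : Type*} [NormedAddCommGroup V] [InnerProductSpace ℝ V]
    (φ : V →ₗ[ℝ] V) (ξ : V) (hξ : ‖ξ‖ = 1)
    (hφ2 : ∀ U : V, φ (φ U) = -U + ⟪U, ξ⟫ • ξ)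
    (hφinner : ∀ U W : V, ⟪φ U, φ W⟫ = ⟪U, W⟫ - ⟪U, ξ⟫ * ⟪W, ξ⟫)
    (ρ : ℝ) (hρ : ρ ≠ 0) (e₁ e₂ H : V)
    (he₁ : ‖e₁‖ = 1) (he₂ : ‖e₂‖ = 1) (he₁e₂ : ⟪e₁, e₂⟫ = 0)
    (hηe₁ : ⟪e₁, ξ⟫ = 0) (hηe₂ : ⟪e₂, ξ⟫ = 0)
    (hHe₁ : ⟪H, e₁⟫ = 0) (hHe₂ : ⟪H, e₂⟫ = 0) (hηH : ⟪H, ξ⟫ = 0)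
    (hanti : ⟪e₁, φ e₂⟫ = 0)
    (hR : cosR φ ξ ρ e₁ e₂ H = 0) :
    ⟪φ H, e₁⟫ = 0 ∧ ⟪φ H, e₂⟫ = 0 := by
  have hH₁ : ⟪e₁, H⟫ = 0 := by rw [real_inner_comm]; exact hHe₁
  have hH₂ : ⟪e₂, H⟫ = 0 := by rw [real_inner_comm]; exact hHe₂
  have key : ⟪e₁, φ H⟫ • φ e₂ - ⟪e₂, φ H⟫ • φ e₁ = 0 := by
    have h : (ρ / 4) • (⟪e₁, φ H⟫ • φ e₂ - ⟪e₂, φ H⟫ • φ e₁) = 0 := by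
      simpa [cosR, hH₁, hH₂, hηe₁, hηe₂, hanti] using hR
    exact (smul_eq_zero.mp h).resolve_left (by positivity)
  have h₁₁ : ⟪φ e₁, φ e₁⟫ = 1 := by
    rw [hφinner, real_inner_self_eq_norm_sq, he₁, hηe₁]; norm_num
  have h₂₂ : ⟪φ e₂, φ e₂⟫ = 1 := by
    rw [hφinner, real_inner_self_eq_norm_sq, he₂, hηe₂]; norm_num
  have h₁₂ : ⟪φ e₁, φ e₂⟫ = 0 := by
    rw [hφinner, he₁e₂, hηe₁]; norm_num
  have h₂₁ : ⟪φ e₂, φ e₁⟫ = 0 := by rw [real_inner_comm]; exact h₁₂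
  rw [real_inner_comm e₁, real_inner_comm e₂]
  constructor
  · simpa [inner_sub_left, real_inner_smul_left, h₂₂, h₁₂, -inner_self_eq_norm_sq_to_K]
      using congrArg (fun v => ⟪v, φ e₂⟫) key
  · simpa [inner_sub_left, real_inner_smul_left, h₁₁, h₂₁, -inner_self_eq_norm_sq_to_K]
      using congrArg (fun v => ⟪v, φ e₁⟫) key
end
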